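/- arXiv:1907.01863 — 3 statements merged into one kernel-verified Lean document; each statement's English description precedes it below -/
import Mathlib

section
/- Let G be a chordal graph of maximum degree Δ and let (T,B) be a clique tree of G rooted at an arbitrary node. Let x be a vertex of G and let C_i, C_j be two nodes of T whose bags contain x. Then h(C_j) − h(C_i) ≤ Δ. -/
/-- A graph is chordal if it contains no induced cycle of length at least 4. -/
def IsChordal {V : Type*} (G : SimpleGraph V) : Prop :=
  ∀ n : ℕ, 4 ≤ n → ¬∃ f : Fin n ↪ V,
    ∀ i j, G.Adj (f i) (f j) ↔ (SimpleGraph.cycleGraph n).Adj i j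

/-- A graph is `d`-degenerate if every nonempty (induced) subgraph has a vertex
of degree at most `d` inside it. -/
def Degenerate {V : Type*} [DecidableEq V] (G : SimpleGraph V) [DecidableRel G.Adj]
    (d : ℕ) : Prop :=
  ∀ S : Finset V, S.Nonempty → ∃ v ∈ S, (S.filter fun u => G.Adj v u).card ≤ d

/-- A proper coloring of `G` with colors in `{1, …, k}`. -/
def ProperColoring {V : Type*} (G : SimpleGraph V) (k : ℕ) (c : V → ℕ) : Prop :=
  (∀ v, c v ∈ Finset.Icc 1 k) ∧ ∀ u v, G.Adj u v → c u ≠ c v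

/-- A recoloring sequence of length `m`: all colorings proper with `k` colors,
consecutive colorings differ on exactly one vertex. -/
def RecolorSeq {V : Type*} (G : SimpleGraph V) (k m : ℕ) (f : ℕ → V → ℕ) : Prop :=
  (∀ t ≤ m, ProperColoring G k (f t)) ∧ ∀ t < m, ∃! v, f (t + 1) v ≠ f t v

/-- The sequence recolors only the vertices of `S`. -/
def RecolorsOnly {V : Type*} (f : ℕ → V → ℕ) (m : ℕ) (S : Set V) : Prop :=
  ∀ t < m, ∀ v, v ∉ S → f (t + 1) v = f t v

/-- The number of times a vertex `v` is recolored along the first `m` steps. -/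
def TimesRecolored {V : Type*} (f : ℕ → V → ℕ) (m : ℕ) (v : V) : ℕ :=
  ((Finset.range m).filter fun t => f (t + 1) v ≠ f t v).card

/-- `(T, bag)` is a clique tree of `G`. -/
def IsCliqueTree {V W : Type*} [DecidableEq V] (G : SimpleGraph V) (T : SimpleGraph W)
    (bag : W → Finset V) : Prop :=
  T.IsTree ∧ (∀ U, G.IsClique ↑(bag U)) ∧
  (∀ x : V, (T.induce {U | x ∈ bag U}).Connected) ∧
  (∀ U U', T.Adj U U' → (bag U \ bag U').Nonempty)

/-- `ord` is a perfect elimination ordering of `G`. -/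
def IsPEO {V : Type*} {n : ℕ} (G : SimpleGraph V) (ord : V ≃ Fin n) : Prop :=
  ∀ v u w, G.Adj v u → G.Adj v w → ord v < ord u → ord v < ord w → u ≠ w → G.Adj u w

/-- `c0` is the greedy coloring of `G` along the reverse of the ordering `ord`:
each vertex gets the least color (≥ 1) not used by its neighbors later in `ord`. -/
def IsGreedy {V : Type*} {n : ℕ} (G : SimpleGraph V) (ord : V ≃ Fin n) (c0 : V → ℕ) : Prop :=
  ∀ v, c0 v = sInf {m : ℕ | 1 ≤ m ∧ ∀ u, G.Adj v u → ord v < ord u → c0 u ≠ m}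

/-- `s = 3·C(ω,2) + 2`. -/
def bufS (ω : ℕ) : ℕ := 3 * Nat.choose ω 2 + 2

/-- `N = s + (k - ω) + 1`. -/
def bufN (ω k : ℕ) : ℕ := bufS ω + (k - ω) + 1

/-- `U` belongs to the subtree of `T` rooted at `Ce` (w.r.t. the root `root`). -/
def InSubtree {W : Type*} (T : SimpleGraph W) (root Ce U : W) : Prop :=
  T.dist root U = T.dist root Ce + T.dist Ce U

/-- Vertex `v` starts at height `h` in the subtree of `T` rooted at `Ce`: `h` is the
maximum height of a bag of the subtree containing `v`. -/
def StartsAt {V W : Type*} (T : SimpleGraph W) (bag : W → Finset V) (root Ce : W)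
    (v : V) (h : ℕ) : Prop :=
  (∃ U, InSubtree T root Ce U ∧ v ∈ bag U ∧ T.dist Ce U = h) ∧
  ∀ U, InSubtree T root Ce U → v ∈ bag U → T.dist Ce U ≤ h

/-- The block `Q_j` (for `1 ≤ j ≤ 3N`) of the buffer rooted at `Ce`. -/
def Block {V W : Type*} (T : SimpleGraph W) (bag : W → Finset V) (root Ce : W)
    (Δ Nn j : ℕ) : Set V :=
  {v | ∃ h, StartsAt T bag root Ce v h ∧ (3 * Nn - j) * Δ ≤ h ∧ h < (3 * Nn - j + 1) * Δ}

/-- The region `R_i = A_i ∪ B_i ∪ C_i = Q_{3i-2} ∪ Q_{3i-1} ∪ Q_{3i}`. -/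
def RegionSet {V W : Type*} (T : SimpleGraph W) (bag : W → Finset V) (root Ce : W)
    (Δ Nn i : ℕ) : Set V :=
  Block T bag root Ce Δ Nn (3 * i - 2) ∪ Block T bag root Ce Δ Nn (3 * i - 1) ∪
    Block T bag root Ce Δ Nn (3 * i)

/-- The union of the regions `R_lo, …, R_hi`. -/
def Regions {V W : Type*} (T : SimpleGraph W) (bag : W → Finset V) (root Ce : W)
    (Δ Nn lo hi : ℕ) : Set V :=
  {v | ∃ i, lo ≤ i ∧ i ≤ hi ∧ v ∈ RegionSet T bag root Ce Δ Nn i}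

/-- Closed neighborhood of a set of vertices. -/
def closedNbhd {V : Type*} (G : SimpleGraph V) (S : Set V) : Set V :=
  S ∪ {u | ∃ v ∈ S, G.Adj v u}

/-- A color vector: an injective map from the classes `{1,…,ω}` to the colors `{1,…,k}`. -/
def IsColorVector (ω k : ℕ) (νv : ℕ → ℕ) : Prop :=
  (∀ p ∈ Finset.Icc 1 ω, νv p ∈ Finset.Icc 1 k) ∧ Set.InjOn νv (Set.Icc 1 ω)

/-- Vector of block `A_i` in a tuple of vectors indexed by blocks. -/
def vA (ν : ℕ → ℕ → ℕ) (i : ℕ) : ℕ → ℕ := ν (3 * i - 2)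
/-- Vector of block `B_i`. -/
def vB (ν : ℕ → ℕ → ℕ) (i : ℕ) : ℕ → ℕ := ν (3 * i - 1)
/-- Vector of block `C_i`. -/
def vC (ν : ℕ → ℕ → ℕ) (i : ℕ) : ℕ → ℕ := ν (3 * i)

/-- Region `R_i` is a waiting region: the three vectors agree on every class. -/
def WaitingAt (ω : ℕ) (ν : ℕ → ℕ → ℕ) (i : ℕ) : Prop :=
  ∀ m ∈ Finset.Icc 1 ω, vA ν i m = vB ν i m ∧ vB ν i m = vC ν i m

/-- `(a,b,c)` is a color region for class `p` and colors `c1` (canonical, disappears)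
and `z` (non-canonical, appears). -/
def ColorRegionVec (ω k : ℕ) (a b c : ℕ → ℕ) (p c1 z : ℕ) : Prop :=
  p ∈ Finset.Icc 1 ω ∧ c1 ∈ Finset.Icc 1 ω ∧ z ∈ Finset.Icc (ω + 1) k ∧
  (∀ m ∈ Finset.Icc 1 ω, m ≠ p → a m = b m ∧ b m = c m ∧ a m ≠ c1 ∧ a m ≠ z) ∧
  a p = c1 ∧ b p = z ∧ c p = z

/-- Region `R_i` is a color region for class `p` and colors `c1, z`. -/
def ColorRegionAt (ω k : ℕ) (ν : ℕ → ℕ → ℕ) (i p c1 z : ℕ) : Prop :=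
  ColorRegionVec ω k (vA ν i) (vB ν i) (vC ν i) p c1 z

/-- `(a,b,c)` is a transposition region for classes `p ≠ q`, temporary colors `z, z'`,
exchanging the canonical colors `c1` and `c2`. -/
def TranspositionVecC (ω k : ℕ) (a b c : ℕ → ℕ) (p q z z' c1 c2 : ℕ) : Prop :=
  p ∈ Finset.Icc 1 ω ∧ q ∈ Finset.Icc 1 ω ∧ p ≠ q ∧
  z ∈ Finset.Icc (ω + 1) k ∧ z' ∈ Finset.Icc (ω + 1) k ∧ z ≠ z' ∧
  c1 ∈ Finset.Icc 1 ω ∧ c2 ∈ Finset.Icc 1 ω ∧ c1 ≠ c2 ∧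
  (∀ m ∈ Finset.Icc 1 ω, m ≠ p → m ≠ q →
    a m = b m ∧ b m = c m ∧ a m ∈ Finset.Icc 1 ω ∧
    a m ≠ c1 ∧ a m ≠ c2 ∧ a m ≠ z ∧ a m ≠ z') ∧
  a p = c1 ∧ b p = z ∧ c p = c2 ∧ a q = c2 ∧ b q = z' ∧ c q = c1

/-- `(a,b,c)` is a transposition region for classes `p ≠ q` with temporary colors `z, z'`. -/
def TranspositionVec (ω k : ℕ) (a b c : ℕ → ℕ) (p q z z' : ℕ) : Prop :=
  ∃ c1 c2, TranspositionVecC ω k a b c p q z z' c1 c2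

/-- Region `R_i` is a transposition region for classes `p ≠ q` with temporaries `z, z'`. -/
def TranspositionAt (ω k : ℕ) (ν : ℕ → ℕ → ℕ) (i p q z z' : ℕ) : Prop :=
  TranspositionVec ω k (vA ν i) (vB ν i) (vC ν i) p q z z'

/-- Region `R_i` is a transposition region with all data explicit. -/
def TranspositionAtC (ω k : ℕ) (ν : ℕ → ℕ → ℕ) (i p q z z' c1 c2 : ℕ) : Prop :=
  TranspositionVecC ω k (vA ν i) (vB ν i) (vC ν i) p q z z' c1 c2

/-- The tuple `ν` (indexed by blocks `1,…,3N`) makes the buffer valid. -/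
def ValidVec (ω k : ℕ) (ν : ℕ → ℕ → ℕ) : Prop :=
  (∀ j ∈ Finset.Icc 1 (3 * bufN ω k), IsColorVector ω k (ν j)) ∧
  (∀ i ∈ Finset.Icc 1 (bufN ω k - 1), ∀ m ∈ Finset.Icc 1 ω, vC ν i m = vA ν (i + 1) m) ∧
  (∀ m ∈ Finset.Icc 1 ω, vA ν 1 m = m ∧ vB ν 1 m = m ∧ vC ν 1 m = m) ∧
  (∃ z z', ∀ i ∈ Finset.Icc 2 (bufS ω - 1),
    WaitingAt ω ν i ∨ ∃ p q, TranspositionAt ω k ν i p q z z') ∧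
  (∀ i ∈ Finset.Icc (bufS ω + 1) (bufN ω k - 1),
    WaitingAt ω ν i ∨ ∃ p c1 z, ColorRegionAt ω k ν i p c1 z) ∧
  WaitingAt ω ν (bufS ω) ∧ WaitingAt ω ν (bufN ω k)

/-- The tuple `ν` makes the buffer almost valid. -/
def AlmostValidVec (ω k : ℕ) (ν : ℕ → ℕ → ℕ) : Prop :=
  (∀ j ∈ Finset.Icc 1 (3 * bufN ω k), IsColorVector ω k (ν j)) ∧
  (∀ i ∈ Finset.Icc 1 (bufN ω k - 1), ∀ m ∈ Finset.Icc 1 ω, vC ν i m = vA ν (i + 1) m) ∧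
  (∀ m ∈ Finset.Icc 1 ω, vA ν 1 m = m ∧ vB ν 1 m = m ∧ vC ν 1 m = m) ∧
  (∃ z z', ∀ i ∈ Finset.Icc 2 (bufS ω - 1),
    WaitingAt ω ν i ∨ ∃ p q, TranspositionAt ω k ν i p q z z') ∧
  (∀ i ∈ Finset.Icc (bufS ω + 1) (bufN ω k - 1),
    WaitingAt ω ν i ∨ ∃ p c1 z, ColorRegionAt ω k ν i p c1 z) ∧
  (WaitingAt ω ν (bufS ω) ∨ ∃ p q z z', TranspositionAt ω k ν (bufS ω) p q z z') ∧
  WaitingAt ω ν 1 ∧ WaitingAt ω ν (bufN ω k)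

/-- Every block of the buffer rooted at `Ce` is well-colored for its vector under `α`. -/
def BufferWellColored {V W : Type*} (T : SimpleGraph W) (bag : W → Finset V)
    (root Ce : W) (Δ Nn : ℕ) (c0 α : V → ℕ) (ν : ℕ → ℕ → ℕ) : Prop :=
  ∀ j ∈ Finset.Icc 1 (3 * Nn), ∀ v ∈ Block T bag root Ce Δ Nn j, α v = ν j (c0 v)

/-- The class `p` is internal to the buffer rooted at `Ce`. -/
def InternalClass {V W : Type*} (G : SimpleGraph V) (T : SimpleGraph W)
    (bag : W → Finset V) (root Ce : W) (Δ Nn : ℕ) (c0 : V → ℕ) (p : ℕ) : Prop :=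
  closedNbhd G (RegionSet T bag root Ce Δ Nn Nn ∩ {v | c0 v = p}) ⊆
    RegionSet T bag root Ce Δ Nn (Nn - 1) ∪ RegionSet T bag root Ce Δ Nn Nn

/-- `νC` is a vector associated with a clique node with bag `bagC`: it agrees with the
current coloring `α` on the classes present in the bag. -/
def AssocVec {V : Type*} (c0 α : V → ℕ) (bagC : Finset V) (νC : ℕ → ℕ) : Prop :=
  ∀ v ∈ bagC, νC (c0 v) = α v

/-- The border error: number of classes on which the last vector differs from `νC`. -/
def BorderErr (ω Nn : ℕ) (νC : ℕ → ℕ) (ν : ℕ → ℕ → ℕ) : ℕ :=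
  ((Finset.Icc 1 ω).filter fun p => vC ν Nn p ≠ νC p).card

/-- `S` is a child of `C` in the tree `T` rooted at `root`. -/
def IsChild {W : Type*} (T : SimpleGraph W) (root C S : W) : Prop :=
  T.Adj C S ∧ T.dist root S = T.dist root C + 1

/-- The coloring `α` is treated up to the node `Snode`. -/
def TreatedUpTo {V W : Type*} (T : SimpleGraph W) (bag : W → Finset V) (root : W)
    (ω Δ k : ℕ) (c0 : V → ℕ) (Snode : W) (α : V → ℕ) : Prop :=
  (∀ v h, StartsAt T bag root Snode v h → 3 * Δ * bufN ω k < h → α v = c0 v) ∧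
  ∃ ν, BufferWellColored T bag root Snode Δ (bufN ω k) c0 α ν ∧ ValidVec ω k ν

/-- In an acyclic graph, a path between two vertices of a set that induces a connected
subgraph stays in that set. -/
lemma SimpleGraph.IsAcyclic.mem_of_mem_support_of_induce_preconnected {W : Type*}
    {T : SimpleGraph W} (hT : T.IsAcyclic) {s : Set W} (hs : (T.induce s).Preconnected)
    {u v : W} {p : T.Walk u v} (hp : p.IsPath) (hu : u ∈ s) (hv : v ∈ s)
    {y : W} (hy : y ∈ p.support) : y ∈ s := by
  classical
  obtain ⟨q, hq⟩ := (hs ⟨u, hu⟩ ⟨v, hv⟩).exists_isPath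
  have hq' : (q.map (SimpleGraph.Embedding.induce s).toHom).IsPath :=
    hq.map Subtype.val_injective
  have h : p = q.map (SimpleGraph.Embedding.induce s).toHom :=
    congrArg Subtype.val ((hT.subsingleton_path u v).elim ⟨p, hp⟩ ⟨_, hq'⟩)
  have hy' : y ∈ (q.map (SimpleGraph.Embedding.induce s).toHom).support := h ▸ hy
  obtain ⟨z, -, rfl⟩ := List.mem_map.1 ((SimpleGraph.Walk.support_map _ q) ▸ hy')
  exact z.2

/-- Along a path of a clique tree ending at a nonempty bag, the bags cover more vertices than
the path has edges. -/
lemma IsCliqueTree.length_lt_card_biUnion_support {V W : Type*} [DecidableEq V] [DecidableEq W]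
    {G : SimpleGraph V} {T : SimpleGraph W} {bag : W → Finset V} (hT : IsCliqueTree G T bag)
    {u v : W} (p : T.Walk u v) (hp : p.IsPath) (hv : (bag v).Nonempty) :
    p.length < (p.support.toFinset.biUnion bag).card := by
  induction p with
  | nil => simpa using hv
  | @cons u u' v h p ih =>
    obtain ⟨w, hw⟩ := hT.2.2.2 u u' h
    rw [Finset.mem_sdiff] at hw
    have hnot : w ∉ p.support.toFinset.biUnion bag := by
      simp only [Finset.mem_biUnion, List.mem_toFinset, not_exists, not_and]
      intro y hy hwy
      have hq : (SimpleGraph.Walk.cons h (p.takeUntil y hy)).IsPath := by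
        rw [SimpleGraph.Walk.cons_isPath_iff] at hp ⊢
        exact ⟨hp.1.takeUntil hy, fun hu ↦ hp.2 (p.support_takeUntil_subset_support hy hu)⟩
      exact hw.2 (hT.1.isAcyclic.mem_of_mem_support_of_induce_preconnected
        (hT.2.2.1 w).preconnected hq hw.1 hwy (by simp))
    have hsub : insert w (p.support.toFinset.biUnion bag) ⊆
        (SimpleGraph.Walk.cons h p).support.toFinset.biUnion bag := by
      rw [SimpleGraph.Walk.support_cons, List.toFinset_cons, Finset.biUnion_insert]
      exact Finset.insert_subset (Finset.mem_union_left _ hw.1) Finset.subset_union_right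
    have hcard := Finset.card_le_card hsub
    rw [Finset.card_insert_of_notMem hnot] at hcard
    have := ih hp.of_cons hv
    rw [SimpleGraph.Walk.length_cons]
    omega

/-- Two nodes of a clique tree whose bags share the vertex `x` are at distance at most the
degree of `x`. -/
lemma IsCliqueTree.dist_le_degree {V W : Type*} [Fintype V] [DecidableEq V]
    {G : SimpleGraph V} [DecidableRel G.Adj] {T : SimpleGraph W} {bag : W → Finset V}
    (hT : IsCliqueTree G T bag) {x : V} {u v : W} (hu : x ∈ bag u) (hv : x ∈ bag v) :
    T.dist u v ≤ G.degree x := by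
  classical
  obtain ⟨p, hp⟩ := (hT.1.connected.preconnected u v).exists_isPath
  have hsub : p.support.toFinset.biUnion bag ⊆ insert x (G.neighborFinset x) := by
    intro w hw
    simp only [Finset.mem_biUnion, List.mem_toFinset] at hw
    obtain ⟨y, hy, hwy⟩ := hw
    have hxy : x ∈ bag y := hT.1.isAcyclic.mem_of_mem_support_of_induce_preconnected
      (hT.2.2.1 x).preconnected hp hu hv hy
    rw [Finset.mem_insert, SimpleGraph.mem_neighborFinset, or_iff_not_imp_left]
    exact fun hne ↦ hT.2.1 y hxy hwy (Ne.symm hne)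
  have h₁ := hT.length_lt_card_biUnion_support p hp ⟨x, hv⟩
  have h₂ := (Finset.card_le_card hsub).trans (Finset.card_insert_le _ _)
  have h₃ := SimpleGraph.dist_le p
  rw [SimpleGraph.card_neighborFinset_eq_degree] at h₂
  omega

theorem cliqueTree_height_diff_le_maxDegree
    {V W : Type*} [Fintype V] [DecidableEq V]
    (G : SimpleGraph V) [DecidableRel G.Adj] (Δ : ℕ)
    (hchordal : IsChordal G) (hdeg : ∀ v, G.degree v ≤ Δ)
    (T : SimpleGraph W) (bag : W → Finset V) (hT : IsCliqueTree G T bag)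
    (root : W) (x : V) (Ci Cj : W) (hi : x ∈ bag Ci) (hj : x ∈ bag Cj) :
    T.dist root Cj ≤ T.dist root Ci + Δ := by
  have h₁ : T.dist root Cj ≤ T.dist root Ci + T.dist Ci Cj := hT.1.connected.dist_triangle
  have h₂ := (hT.dist_le_degree hi hj).trans (hdeg x)
  omega
end

section
/- Let (𝓑,𝛎) be an almost valid buffer and let c be a canonical color. There exists a unique class p ≤ ω such that ν_{C_s}(p) = c. Furthermore, either ν_Q(p) = c for every block Q of the regions R_{s+1},…,R_N, or there is a (unique) color region among R_{s+1},…,R_{N−1} for the class p in which the color c disappears (i.e. a color region for class p and colors c, z for some non-canonical z). -/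
theorem WaitingAt.vA_eq_vC {ω : ℕ} {ν : ℕ → ℕ → ℕ} {i m : ℕ} (h : WaitingAt ω ν i)
    (hm : m ∈ Finset.Icc 1 ω) : vA ν i m = vC ν i m :=
  (h m hm).1.trans (h m hm).2

/-- A transposition region permutes canonical colors: its last vector is canonical. -/
theorem TranspositionAt.vC_mem {ω k : ℕ} {ν : ℕ → ℕ → ℕ} {i p q z z' m : ℕ}
    (h : TranspositionAt ω k ν i p q z z') (hm : m ∈ Finset.Icc 1 ω) :
    vC ν i m ∈ Finset.Icc 1 ω := by
  obtain ⟨c1, c2, -, -, -, -, -, -, hc1, hc2, -, hrest, -, -, hcp, -, -, hcq⟩ := h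
  by_cases hp : m = p
  · rw [hp, hcp]; exact hc2
  by_cases hq : m = q
  · rw [hq, hcq]; exact hc1
  obtain ⟨hab, hbc, hmem, -⟩ := hrest m hm hp hq
  rw [← hbc, ← hab]; exact hmem

/-- The last vectors of the transposition buffer take canonical colors only. -/
theorem AlmostValidVec.vC_mem {ω k : ℕ} {ν : ℕ → ℕ → ℕ} (h : AlmostValidVec ω k ν)
    {i : ℕ} (hi : 1 ≤ i) (his : i ≤ bufS ω) {m : ℕ} (hm : m ∈ Finset.Icc 1 ω) :
    vC ν i m ∈ Finset.Icc 1 ω := by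
  obtain ⟨-, hcont, hcan, ⟨z, z', htr⟩, -, hs, -, -⟩ := h
  induction i, hi using Nat.le_induction with
  | base => rw [(hcan m hm).2.2]; exact hm
  | succ i hi ih =>
    have hwait : WaitingAt ω ν (i + 1) → vC ν (i + 1) m ∈ Finset.Icc 1 ω := fun hw => by
      rw [← hw.vA_eq_vC hm, ← hcont i (by simp only [bufN, Finset.mem_Icc]; omega) m hm]
      exact ih (by omega)
    rcases his.eq_or_lt with heq | hlt
    · rw [← heq] at hs
      rcases hs with hw | ⟨p, q, y, y', ht⟩
      · exact hwait hw
      · exact ht.vC_mem hm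
    · rcases htr (i + 1) (by simp only [Finset.mem_Icc]; omega) with hw | ⟨p, q, ht⟩
      · exact hwait hw
      · exact ht.vC_mem hm

/-- Every canonical color is the color of some class at the end of the transposition buffer. -/
theorem AlmostValidVec.exists_vC_bufS_eq {ω k : ℕ} {ν : ℕ → ℕ → ℕ}
    (h : AlmostValidVec ω k ν) {c : ℕ} (hc : c ∈ Finset.Icc 1 ω) :
    ∃ p ∈ Finset.Icc 1 ω, vC ν (bufS ω) p = c := by
  have hinj : Set.InjOn (vC ν (bufS ω)) (Finset.Icc 1 ω : Finset ℕ) := by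
    rw [Finset.coe_Icc]
    exact (h.1 _ (by simp only [bufN, bufS, Finset.mem_Icc]; omega)).2
  have hmaps : Set.MapsTo (vC ν (bufS ω)) (Finset.Icc 1 ω : Finset ℕ)
      (Finset.Icc 1 ω : Finset ℕ) := fun m hm =>
    h.vC_mem (by simp only [bufS]; omega) le_rfl hm
  obtain ⟨p, hp, hpc⟩ := Finset.surjOn_of_injOn_of_card_le _ hmaps hinj le_rfl hc
  exact ⟨p, hp, hpc⟩

theorem vA_succ (ν : ℕ → ℕ → ℕ) (i : ℕ) : vA ν (i + 1) = ν (3 * i + 1) := rfl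

theorem vB_succ (ν : ℕ → ℕ → ℕ) (i : ℕ) : vB ν (i + 1) = ν (3 * i + 2) := rfl

theorem vC_succ (ν : ℕ → ℕ → ℕ) (i : ℕ) : vC ν (i + 1) = ν (3 * i + 3) := rfl

/-- If a class keeps its color inside region `R_{i+1}` and had color `c` on all blocks from
the end of `R_s` to the end of `R_i`, then it has color `c` up to the end of `R_{i+1}`. -/
theorem forall_block_eq_succ {ν : ℕ → ℕ → ℕ} {s i p c : ℕ}
    (hcont : vC ν i p = vA ν (i + 1) p) (hsi : s ≤ i)
    (hi : ∀ j ∈ Finset.Icc (3 * s) (3 * i), ν j p = c)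
    (hAB : vA ν (i + 1) p = vB ν (i + 1) p) (hBC : vB ν (i + 1) p = vC ν (i + 1) p) :
    ∀ j ∈ Finset.Icc (3 * s) (3 * (i + 1)), ν j p = c := by
  have hC : vC ν i p = c := hi (3 * i) (by simp only [Finset.mem_Icc]; omega)
  rw [vB_succ, vC_succ] at hBC
  rw [vA_succ, vB_succ] at hAB
  rw [vA_succ] at hcont
  intro j hj
  rw [Finset.mem_Icc] at hj
  by_cases hji : j ≤ 3 * i
  · exact hi j (Finset.mem_Icc.2 ⟨hj.1, hji⟩)
  obtain rfl | rfl | rfl : j = 3 * i + 1 ∨ j = 3 * i + 2 ∨ j = 3 * i + 3 := by omega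
  all_goals omega

/-- In the color buffer a class either keeps its canonical color or loses it in a color region. -/
theorem AlmostValidVec.forall_block_eq_or_exists_colorRegionAt {ω k : ℕ} {ν : ℕ → ℕ → ℕ}
    (h : AlmostValidVec ω k ν) {p c : ℕ} (hp : p ∈ Finset.Icc 1 ω)
    (hpc : vC ν (bufS ω) p = c) {i : ℕ} (hsi : bufS ω ≤ i) (hiN : i ≤ bufN ω k) :
    (∀ j ∈ Finset.Icc (3 * bufS ω) (3 * i), ν j p = c) ∨
      ∃ j ∈ Finset.Icc (bufS ω + 1) (bufN ω k - 1), ∃ z, ColorRegionAt ω k ν j p c z := by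
  obtain ⟨-, hcont, -, -, hcol, -, -, hN⟩ := h
  have hs : 1 ≤ bufS ω := by simp only [bufS]; omega
  induction i, hsi using Nat.le_induction with
  | base =>
    left
    intro j hj
    rw [Finset.Icc_self, Finset.mem_singleton] at hj
    rw [hj]; exact hpc
  | succ i hsi ih =>
    rcases ih (by omega) with hall | hex
    · have hco := hcont i (by simp only [Finset.mem_Icc]; omega) p hp
      have hwait : WaitingAt ω ν (i + 1) →
          ∀ j ∈ Finset.Icc (3 * bufS ω) (3 * (i + 1)), ν j p = c := fun hw =>
        forall_block_eq_succ hco hsi hall (hw p hp).1 (hw p hp).2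
      rcases hiN.eq_or_lt with heq | hlt
      · rw [← heq] at hN
        exact Or.inl (hwait hN)
      have hi1 : i + 1 ∈ Finset.Icc (bufS ω + 1) (bufN ω k - 1) := by
        simp only [Finset.mem_Icc]; omega
      rcases hcol (i + 1) hi1 with hw | ⟨q, c1, z, hr⟩
      · exact Or.inl (hwait hw)
      by_cases hpq : p = q
      · subst hpq
        have hc1 : c1 = c := by
          rw [← hall (3 * i) (by simp only [Finset.mem_Icc]; omega)]
          exact hr.2.2.2.2.1.symm.trans hco.symm
        subst hc1
        exact Or.inr ⟨i + 1, hi1, z, hr⟩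
      · obtain ⟨hAB, hBC, -⟩ := hr.2.2.2.1 p hp hpq
        exact Or.inl (forall_block_eq_succ hco hsi hall hAB hBC)
    · exact Or.inr hex

/-- In the color buffer a class with a non-canonical color keeps a non-canonical color. -/
theorem AlmostValidVec.lt_vC_of_colorRegionAt {ω k : ℕ} {ν : ℕ → ℕ → ℕ}
    (h : AlmostValidVec ω k ν) {p c z j : ℕ} (hsj : bufS ω + 1 ≤ j)
    (hr : ColorRegionAt ω k ν j p c z) {i : ℕ} (hji : j ≤ i) (hiN : i ≤ bufN ω k - 1) :
    ω < vC ν i p := by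
  obtain ⟨-, hcont, -, -, hcol, -, -, -⟩ := h
  obtain ⟨hp, -, hz, -, -, -, hCp⟩ := hr
  induction i, hji using Nat.le_induction with
  | base => rw [hCp]; exact (Finset.mem_Icc.1 hz).1
  | succ i hji ih =>
    have hlt : ω < vA ν (i + 1) p := by
      rw [← hcont i (by simp only [Finset.mem_Icc]; omega) p hp]
      exact ih (by omega)
    rcases hcol (i + 1) (by simp only [Finset.mem_Icc]; omega) with hw | ⟨q, c1, y, hr⟩
    · rwa [← hw.vA_eq_vC hp]
    by_cases hpq : p = q
    · subst hpq
      have := Finset.mem_Icc.1 hr.2.1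
      have := hr.2.2.2.2.1
      omega
    · obtain ⟨hAB, hBC, -⟩ := hr.2.2.2.1 p hp hpq
      rwa [← hBC, ← hAB]

/-- A class loses a canonical color in at most one region of the color buffer. -/
theorem AlmostValidVec.not_lt_of_colorRegionAt {ω k : ℕ} {ν : ℕ → ℕ → ℕ}
    (h : AlmostValidVec ω k ν) {p c c' z z' j j' : ℕ} (hsj : bufS ω + 1 ≤ j)
    (hr : ColorRegionAt ω k ν j p c z) (hj' : j' ≤ bufN ω k - 1)
    (hr' : ColorRegionAt ω k ν j' p c' z') : ¬j < j' := by
  intro hlt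
  obtain ⟨i, rfl⟩ : ∃ i, j' = i + 1 := ⟨j' - 1, by omega⟩
  have hC := h.lt_vC_of_colorRegionAt hsj hr (i := i) (by omega) (by omega)
  have hco := h.2.1 i (by simp only [Finset.mem_Icc]; omega) p hr.1
  have hA := hr'.2.2.2.2.1
  have hc := (Finset.mem_Icc.1 hr'.2.1).2
  omega

theorem canonical_color_in_color_buffer
    {V W : Type*} [Fintype V] [DecidableEq V]
    (G : SimpleGraph V) [DecidableRel G.Adj] (ω Δ k : ℕ)
    (hchordal : IsChordal G)
    (hcliqub : ∀ S : Finset V, G.IsClique ↑S → S.card ≤ ω)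
    (hcliqmax : ∃ S : Finset V, G.IsClique ↑S ∧ S.card = ω)
    (hdeg : ∀ v, G.degree v ≤ Δ)
    (hk : ω + 3 ≤ k)
    (ord : V ≃ Fin (Fintype.card V)) (hpeo : IsPEO G ord)
    (c0 : V → ℕ) (hgreedy : IsGreedy G ord c0) (hc0 : ProperColoring G ω c0)
    (T : SimpleGraph W) (bag : W → Finset V) (hT : IsCliqueTree G T bag) (root : W)
    (Ce : W) (α : V → ℕ) (hα : ProperColoring G k α)
    (ν : ℕ → ℕ → ℕ)
    (hwc : BufferWellColored T bag root Ce Δ (bufN ω k) c0 α ν)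
    (hav : AlmostValidVec ω k ν)
    (cc : ℕ) (hcc : cc ∈ Finset.Icc 1 ω) :
    ∃ p, (p ∈ Finset.Icc 1 ω ∧ vC ν (bufS ω) p = cc) ∧
      (∀ p', p' ∈ Finset.Icc 1 ω → vC ν (bufS ω) p' = cc → p' = p) ∧
      ((∀ j ∈ Finset.Icc (3 * bufS ω + 1) (3 * bufN ω k), ν j p = cc) ∨
        (∃ j, j ∈ Finset.Icc (bufS ω + 1) (bufN ω k - 1) ∧
          (∃ z, ColorRegionAt ω k ν j p cc z) ∧
          (∀ j', j' ∈ Finset.Icc (bufS ω + 1) (bufN ω k - 1) →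
            (∃ z, ColorRegionAt ω k ν j' p cc z) → j' = j))) := by
  obtain ⟨p, hp, hpc⟩ := hav.exists_vC_bufS_eq hcc
  refine ⟨p, ⟨hp, hpc⟩, fun p' hp' hpc' => ?_, ?_⟩
  · exact (hav.1 (3 * bufS ω) (by simp only [bufN, bufS, Finset.mem_Icc]; omega)).2
      (Finset.mem_Icc.1 hp') (Finset.mem_Icc.1 hp) (hpc'.trans hpc.symm)
  · rcases hav.forall_block_eq_or_exists_colorRegionAt hp hpc (i := bufN ω k)
      (by simp only [bufN]; omega) le_rfl with hall | ⟨j, hj, z, hr⟩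
    · exact Or.inl fun j hj => hall j (Finset.Icc_subset_Icc_left (Nat.le_succ _) hj)
    · refine Or.inr ⟨j, hj, ⟨z, hr⟩, ?_⟩
      rintro j' hj' ⟨z', hr'⟩
      rw [Finset.mem_Icc] at hj hj'
      exact le_antisymm (not_lt.1 (hav.not_lt_of_colorRegionAt hj.1 hr hj'.2 hr'))
        (not_lt.1 (hav.not_lt_of_colorRegionAt hj'.1 hr' hj.2 hr))
end

section
/- Let (𝓑,𝛎) be an almost valid buffer. There exists a waiting region among R_{s+1},…,R_{N−1} if and only if there exists a non-canonical color that appears in no vector ν_Q for Q a block of R_{s+1},…,R_N. -/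
/-- The non-canonical colors used by a vector on the classes `1, …, ω`. -/
def nonCanonicalColors (ω k : ℕ) (a : ℕ → ℕ) : Finset ℕ :=
  Finset.Icc (ω + 1) k ∩ (Finset.Icc 1 ω).image a

theorem mem_nonCanonicalColors {ω k z : ℕ} {a : ℕ → ℕ} :
    z ∈ nonCanonicalColors ω k a ↔
      z ∈ Finset.Icc (ω + 1) k ∧ ∃ p ∈ Finset.Icc 1 ω, a p = z := by
  rw [nonCanonicalColors, Finset.mem_inter, Finset.mem_image]

theorem nonCanonicalColors_congr {ω k : ℕ} {a b : ℕ → ℕ}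
    (h : ∀ m ∈ Finset.Icc 1 ω, a m = b m) :
    nonCanonicalColors ω k a = nonCanonicalColors ω k b := by
  ext z
  simp only [mem_nonCanonicalColors]
  refine and_congr_right fun _ => exists_congr fun p => and_congr_right fun hp => ?_
  rw [h p hp]

theorem nonCanonicalColors_eq_empty {ω k : ℕ} {a : ℕ → ℕ}
    (h : ∀ m ∈ Finset.Icc 1 ω, a m ∈ Finset.Icc 1 ω) :
    nonCanonicalColors ω k a = ∅ := by
  refine Finset.eq_empty_of_forall_notMem fun z hz => ?_
  obtain ⟨hz, p, hp, rfl⟩ := mem_nonCanonicalColors.1 hz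
  have := h p hp
  simp only [Finset.mem_Icc] at this hz
  omega

theorem ColorRegionVec.nonCanonicalColors_eq {ω k p c1 z : ℕ} {a b c : ℕ → ℕ}
    (h : ColorRegionVec ω k a b c p c1 z) :
    z ∉ nonCanonicalColors ω k a ∧
      nonCanonicalColors ω k b = insert z (nonCanonicalColors ω k a) := by
  obtain ⟨hp, hc1, hz, hm, hap, hbp, -⟩ := h
  have hc1z : c1 ≠ z := by
    simp only [Finset.mem_Icc] at hc1 hz
    omega
  constructor
  · intro hza
    obtain ⟨-, q, hq, hqz⟩ := mem_nonCanonicalColors.1 hza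
    by_cases hqp : q = p
    · subst hqp
      exact hc1z (hap.symm.trans hqz)
    · exact (hm q hq hqp).2.2.2 hqz
  · ext y
    simp only [Finset.mem_insert, mem_nonCanonicalColors]
    constructor
    · rintro ⟨hy, q, hq, hqy⟩
      by_cases hqp : q = p
      · subst hqp
        exact Or.inl (hqy.symm.trans hbp)
      · exact Or.inr ⟨hy, q, hq, (hm q hq hqp).1.trans hqy⟩
    · rintro (rfl | ⟨hy, q, hq, hqy⟩)
      · exact ⟨hz, p, hp, hbp⟩
      · have hqp : q ≠ p := by
          rintro rfl
          simp only [Finset.mem_Icc] at hy hc1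
          omega
        exact ⟨hy, q, hq, (hm q hq hqp).1.symm.trans hqy⟩

theorem ColorRegionVec.eq_on {ω k p c1 z : ℕ} {a b c : ℕ → ℕ}
    (h : ColorRegionVec ω k a b c p c1 z) : ∀ m ∈ Finset.Icc 1 ω, b m = c m := by
  obtain ⟨-, -, -, hm, -, hbp, hcp⟩ := h
  intro m hmω
  by_cases hmp : m = p
  · subst hmp
    exact hbp.trans hcp.symm
  · exact (hm m hmω hmp).2.1

theorem ColorRegionAt.not_waitingAt {ω k i p c1 z : ℕ} {ν : ℕ → ℕ → ℕ}
    (h : ColorRegionAt ω k ν i p c1 z) : ¬ WaitingAt ω ν i := by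
  intro hw
  obtain ⟨hp, hc1, hz, -, hap, hbp, -⟩ := h
  have := (hw p hp).1
  simp only [Finset.mem_Icc] at hc1 hz
  omega

theorem TranspositionVec.canonical {ω k p q z z' : ℕ} {a b c : ℕ → ℕ}
    (h : TranspositionVec ω k a b c p q z z') :
    ∀ m ∈ Finset.Icc 1 ω, c m ∈ Finset.Icc 1 ω := by
  obtain ⟨c1, c2, -, -, -, -, -, -, hc1, hc2, -, hm, -, -, hcp, -, -, hcq⟩ := h
  intro m hmω
  by_cases hmp : m = p
  · subst hmp
    rwa [hcp]
  by_cases hmq : m = q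
  · subst hmq
    rwa [hcq]
  obtain ⟨hab, hbc, ha, -⟩ := hm m hmω hmp hmq
  rwa [← hbc, ← hab]

theorem AlmostValidVec.vC_canonical {ω k : ℕ} {ν : ℕ → ℕ → ℕ} (h : AlmostValidVec ω k ν)
    {i : ℕ} (hi : 1 ≤ i) (his : i ≤ bufS ω) :
    ∀ m ∈ Finset.Icc 1 ω, vC ν i m ∈ Finset.Icc 1 ω := by
  obtain ⟨-, hcont, hone, ⟨z, z', htr⟩, -, hs, -, -⟩ := h
  induction i, hi using Nat.le_induction with
  | base =>
    intro m hm
    rwa [(hone m hm).2.2]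
  | succ i hi ih =>
    have hreg : WaitingAt ω ν (i + 1) ∨ ∃ p q z z', TranspositionAt ω k ν (i + 1) p q z z' := by
      rcases his.eq_or_lt with heq | hlt
      · rwa [heq]
      · refine (htr (i + 1) (Finset.mem_Icc.2 (by omega))).imp_right ?_
        rintro ⟨p, q, hpq⟩
        exact ⟨p, q, z, z', hpq⟩
    rcases hreg with hw | ⟨p, q, z, z', hpq⟩
    · intro m hm
      rw [← (hw m hm).2, ← (hw m hm).1,
        ← hcont i (Finset.mem_Icc.2 (by unfold bufN; omega)) m hm]
      exact ih (by omega) m hm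
    · exact TranspositionVec.canonical hpq

section ColorBuffer

variable {ω k : ℕ} {ν : ℕ → ℕ → ℕ}

theorem AlmostValidVec.nonCanonicalColors_vB (h : AlmostValidVec ω k ν) {i : ℕ}
    (hi : i ∈ Finset.Icc (bufS ω + 1) (bufN ω k - 1)) :
    nonCanonicalColors ω k (vB ν i) = nonCanonicalColors ω k (vA ν (i + 1)) := by
  obtain ⟨-, hcont, -, -, hcol, -⟩ := h
  have hBC : ∀ m ∈ Finset.Icc 1 ω, vB ν i m = vC ν i m := by
    rcases hcol i hi with hw | ⟨p, c1, z, hc⟩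
    · exact fun m hm => (hw m hm).2
    · exact ColorRegionVec.eq_on hc
  refine nonCanonicalColors_congr fun m hm => (hBC m hm).trans (hcont i ?_ m hm)
  simp only [Finset.mem_Icc] at hi ⊢
  omega

theorem AlmostValidVec.nonCanonicalColors_vA_subset_succ (h : AlmostValidVec ω k ν) {i : ℕ}
    (hi : i ∈ Finset.Icc (bufS ω + 1) (bufN ω k - 1)) :
    nonCanonicalColors ω k (vA ν i) ⊆ nonCanonicalColors ω k (vA ν (i + 1)) := by
  rw [← h.nonCanonicalColors_vB hi]
  obtain ⟨-, -, -, -, hcol, -⟩ := h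
  rcases hcol i hi with hw | ⟨p, c1, z, hc⟩
  · exact (nonCanonicalColors_congr fun m hm => (hw m hm).1).subset
  · rw [(ColorRegionVec.nonCanonicalColors_eq hc).2]
    exact Finset.subset_insert _ _

theorem AlmostValidVec.nonCanonicalColors_vA_subset (h : AlmostValidVec ω k ν) {i j : ℕ}
    (hi : bufS ω + 1 ≤ i) (hij : i ≤ j) (hj : j ≤ bufN ω k) :
    nonCanonicalColors ω k (vA ν i) ⊆ nonCanonicalColors ω k (vA ν j) := by
  induction j, hij using Nat.le_induction with
  | base => exact subset_rfl
  | succ j hij ih =>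
    exact (ih (by omega)).trans
      (h.nonCanonicalColors_vA_subset_succ (Finset.mem_Icc.2 (by omega)))

theorem AlmostValidVec.nonCanonicalColors_block_subset (h : AlmostValidVec ω k ν) {j : ℕ}
    (hj : j ∈ Finset.Icc (3 * bufS ω + 1) (3 * bufN ω k)) :
    nonCanonicalColors ω k (ν j) ⊆ nonCanonicalColors ω k (vA ν (bufN ω k)) := by
  rw [Finset.mem_Icc] at hj
  have hA : ∀ i, bufS ω + 1 ≤ i → i ≤ bufN ω k →
      nonCanonicalColors ω k (vA ν i) ⊆ nonCanonicalColors ω k (vA ν (bufN ω k)) :=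
    fun i hi hiN => h.nonCanonicalColors_vA_subset hi hiN le_rfl
  have hB : ∀ i, bufS ω + 1 ≤ i → i ≤ bufN ω k →
      nonCanonicalColors ω k (vB ν i) ⊆ nonCanonicalColors ω k (vA ν (bufN ω k)) := by
    intro i hi hiN
    rcases hiN.eq_or_lt with rfl | hlt
    · exact (nonCanonicalColors_congr fun m hm =>
        (h.2.2.2.2.2.2.2 m hm).1.symm).subset
    · rw [h.nonCanonicalColors_vB (Finset.mem_Icc.2 (by omega))]
      exact hA _ (by omega) hlt
  have hC : ∀ i, bufS ω + 1 ≤ i → i ≤ bufN ω k →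
      nonCanonicalColors ω k (vC ν i) ⊆ nonCanonicalColors ω k (vA ν (bufN ω k)) := by
    intro i hi hiN
    rcases hiN.eq_or_lt with rfl | hlt
    · have hw := h.2.2.2.2.2.2.2
      exact (nonCanonicalColors_congr fun m hm =>
        ((hw m hm).1.trans (hw m hm).2).symm).subset
    · rw [nonCanonicalColors_congr (h.2.1 i (Finset.mem_Icc.2 (by omega)))]
      exact hA _ (by omega) hlt
  obtain ⟨i, rfl | rfl | rfl⟩ : ∃ i, j = 3 * i - 2 ∨ j = 3 * i - 1 ∨ j = 3 * i :=
    ⟨(j + 2) / 3, by omega⟩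
  · exact hA i (by omega) (by omega)
  · exact hB i (by omega) (by omega)
  · exact hC i (by omega) (by omega)

open Classical in
/-- Each region of the color buffer is either waiting or introduces exactly one new
non-canonical color. -/
theorem AlmostValidVec.card_nonCanonicalColors_add_card_waiting (h : AlmostValidVec ω k ν)
    {n : ℕ} (hn : n ≤ k - ω) :
    (nonCanonicalColors ω k (vA ν (bufS ω + 1 + n))).card +
      ((Finset.range n).filter fun t => WaitingAt ω ν (bufS ω + 1 + t)).card = n := by
  induction n with
  | zero =>
    have hcan : ∀ m ∈ Finset.Icc 1 ω, vA ν (bufS ω + 1) m ∈ Finset.Icc 1 ω := by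
      intro m hm
      rw [← h.2.1 (bufS ω) (Finset.mem_Icc.2 (by unfold bufN bufS; omega)) m hm]
      exact h.vC_canonical (by unfold bufS; omega) le_rfl m hm
    simp [nonCanonicalColors_eq_empty hcan]
  | succ n ih =>
    have hi : bufS ω + 1 + n ∈ Finset.Icc (bufS ω + 1) (bufN ω k - 1) := by
      rw [Finset.mem_Icc]
      unfold bufN
      omega
    have ih := ih (by omega)
    rw [← Nat.add_assoc, ← h.nonCanonicalColors_vB hi, Finset.range_add_one,
      Finset.filter_insert]
    rcases h.2.2.2.2.1 _ hi with hw | ⟨p, c1, z, hc⟩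
    · rw [if_pos hw, Finset.card_insert_of_notMem (by simp),
        ← nonCanonicalColors_congr fun m hm => (hw m hm).1]
      omega
    · obtain ⟨hz, heq⟩ := ColorRegionVec.nonCanonicalColors_eq hc
      rw [if_neg hc.not_waitingAt, heq, Finset.card_insert_of_notMem hz]
      omega

end ColorBuffer

theorem waiting_region_iff_unused_noncanonical_color
    {V W : Type*} [Fintype V] [DecidableEq V]
    (G : SimpleGraph V) [DecidableRel G.Adj] (ω Δ k : ℕ)
    (hchordal : IsChordal G)
    (hcliqub : ∀ S : Finset V, G.IsClique ↑S → S.card ≤ ω)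
    (hcliqmax : ∃ S : Finset V, G.IsClique ↑S ∧ S.card = ω)
    (hdeg : ∀ v, G.degree v ≤ Δ)
    (hk : ω + 3 ≤ k)
    (ord : V ≃ Fin (Fintype.card V)) (hpeo : IsPEO G ord)
    (c0 : V → ℕ) (hgreedy : IsGreedy G ord c0) (hc0 : ProperColoring G ω c0)
    (T : SimpleGraph W) (bag : W → Finset V) (hT : IsCliqueTree G T bag) (root : W)
    (Ce : W) (α : V → ℕ) (hα : ProperColoring G k α)
    (ν : ℕ → ℕ → ℕ)
    (hwc : BufferWellColored T bag root Ce Δ (bufN ω k) c0 α ν)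
    (hav : AlmostValidVec ω k ν) :
    (∃ i ∈ Finset.Icc (bufS ω + 1) (bufN ω k - 1), WaitingAt ω ν i) ↔
      (∃ z ∈ Finset.Icc (ω + 1) k,
        ∀ j ∈ Finset.Icc (3 * bufS ω + 1) (3 * bufN ω k),
          ∀ p ∈ Finset.Icc 1 ω, ν j p ≠ z) := by
  classical
  have hN : bufN ω k = bufS ω + 1 + (k - ω) := by
    unfold bufN
    omega
  have hcard := hav.card_nonCanonicalColors_add_card_waiting le_rfl
  rw [← hN] at hcard
  have hIcc : (Finset.Icc (ω + 1) k).card = k - ω := by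
    rw [Nat.card_Icc]
    omega
  have hsub : nonCanonicalColors ω k (vA ν (bufN ω k)) ⊆ Finset.Icc (ω + 1) k :=
    Finset.inter_subset_left
  constructor
  · rintro ⟨i, hi, hw⟩
    rw [Finset.mem_Icc] at hi
    have hpos : 0 < ((Finset.range (k - ω)).filter
        fun t => WaitingAt ω ν (bufS ω + 1 + t)).card := by
      refine Finset.card_pos.2 ⟨i - (bufS ω + 1), ?_⟩
      rw [Finset.mem_filter, Finset.mem_range, Nat.add_sub_cancel' hi.1]
      exact ⟨by omega, hw⟩
    obtain ⟨z, hz, hzN⟩ := Finset.exists_mem_notMem_of_card_lt_card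
      (s := nonCanonicalColors ω k (vA ν (bufN ω k))) (t := Finset.Icc (ω + 1) k) (by omega)
    exact ⟨z, hz, fun j hj p hp hpz => hzN
      (hav.nonCanonicalColors_block_subset hj (mem_nonCanonicalColors.2 ⟨hz, p, hp, hpz⟩))⟩
  · rintro ⟨z, hz, hunused⟩
    have hzN : z ∉ nonCanonicalColors ω k (vA ν (bufN ω k)) := by
      intro hmem
      obtain ⟨-, p, hp, hpz⟩ := mem_nonCanonicalColors.1 hmem
      exact hunused (3 * bufN ω k - 2) (Finset.mem_Icc.2 (by omega)) p hp hpz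
    have hlt := Finset.card_lt_card
      ((Finset.ssubset_iff_of_subset hsub).2 ⟨z, hz, hzN⟩)
    have hpos : 0 < ((Finset.range (k - ω)).filter
        fun t => WaitingAt ω ν (bufS ω + 1 + t)).card := by omega
    obtain ⟨t, ht⟩ := Finset.card_pos.1 hpos
    rw [Finset.mem_filter, Finset.mem_range] at ht
    exact ⟨bufS ω + 1 + t, Finset.mem_Icc.2 (by omega), ht.2⟩
end
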